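/- arXiv:quant-ph/0111039 — 7 statements merged into one kernel-verified Lean document; each statement's English description precedes it below -/
import Mathlib

section
/- Let n ≥ 1, N = 2^n, and ω_N = exp(2πi/N). The twiddle matrix T_{N/2} = diag(1, ω_N, ω_N^2, …, ω_N^{N/2−1}) of size N/2 × N/2 decomposes as the tensor product T_{N/2} = L_{n−1} ⊗ L_{n−2} ⊗ ⋯ ⊗ L_2 ⊗ L_1, where L_j = diag(1, ω_N^{2^{j−1}}) is a 2×2 diagonal matrix. -/
open Matrix Complex Finset

/-- The twiddle matrix `T_{N/2} = diag(1, ω_N, …, ω_N^{N/2-1})` with `ω_N = exp(2πi/N)`,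
where `N = 2*M`. -/
noncomputable def twiddle (M : ℕ) : Matrix (Fin M) (Fin M) ℂ :=
  Matrix.diagonal fun x =>
    Complex.exp (2 * (Real.pi : ℂ) * Complex.I / ((2 * M : ℕ) : ℂ)) ^ (x.val)

/-- The 2×2 diagonal matrix `L_j = diag(1, ω_N^{2^(j-1)})`, `ω_N = exp(2πi/N)`. -/
noncomputable def Lmat (N j : ℕ) : Matrix (Fin 2) (Fin 2) ℂ :=
  Matrix.diagonal fun b =>
    if b.val = 0 then 1
    else Complex.exp (2 * (Real.pi : ℂ) * Complex.I / (N : ℂ)) ^ (2 ^ (j - 1))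

/-- The `k`-th binary digit of `x`, as an element of `Fin 2`. -/
def bit (k x : ℕ) : Fin 2 := ⟨x / 2 ^ k % 2, Nat.mod_lt _ (by norm_num)⟩

/-- Iterated Kronecker product `A_k ⊗ A_{k-1} ⊗ ⋯ ⊗ A_1` of 2×2 matrices, realized on
`Fin (2^k)` via the standard binary index identification (the leftmost, i.e. highest-index,
factor acts on the most significant bit): its `(x,y)` entry is
`∏_{j=1}^{k} A_j[bit_{j-1}(x), bit_{j-1}(y)]`. -/
noncomputable def tensorChain (k : ℕ) (A : ℕ → Matrix (Fin 2) (Fin 2) ℂ) :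
    Matrix (Fin (2 ^ k)) (Fin (2 ^ k)) ℂ :=
  Matrix.of fun x y => ∏ j ∈ Finset.range k, A (j + 1) (bit j x.val) (bit j y.val)

theorem prod_bits_aux (w : ℂ) (x k : ℕ) :
    ∏ j ∈ Finset.range k, (if (bit j x).val = 0 then (1 : ℂ) else w ^ (2 ^ j)) =
      w ^ (x % 2 ^ k) := by
  induction k with
  | zero => simp [Nat.mod_one]
  | succ k ih =>
    rw [Finset.prod_range_succ, ih, Nat.mod_pow_succ, pow_add]
    congr 1
    simp only [bit]
    rcases Nat.mod_two_eq_zero_or_one (x / 2 ^ k) with h | h <;> simp [h]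

theorem mod_eq_of_bits_aux (x y k : ℕ) (h : ∀ j < k, bit j x = bit j y) :
    x % 2 ^ k = y % 2 ^ k := by
  induction k with
  | zero => simp [Nat.mod_one]
  | succ k ih =>
    have h1 : x / 2 ^ k % 2 = y / 2 ^ k % 2 := congrArg Fin.val (h k (Nat.lt_succ_self k))
    rw [Nat.mod_pow_succ, Nat.mod_pow_succ, ih (fun j hj => h j (Nat.lt_succ_of_lt hj)), h1]

/-- For `N = 2^n`, `n ≥ 1`, the twiddle matrix `T_{N/2} = diag(1, ω_N, …, ω_N^{N/2-1})`
decomposes as the tensor product `L_{n-1} ⊗ L_{n-2} ⊗ ⋯ ⊗ L_2 ⊗ L_1` of 2×2 diagonal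
matrices `L_j = diag(1, ω_N^{2^(j-1)})`. -/
theorem twiddle_tensor_decomposition (n : ℕ) (hn : 1 ≤ n) :
    twiddle (2 ^ (n - 1)) = tensorChain (n - 1) (Lmat (2 ^ n)) := by
  obtain ⟨k, rfl⟩ : ∃ k, n = k + 1 := ⟨n - 1, by omega⟩
  change twiddle (2 ^ k) = tensorChain k (Lmat (2 ^ (k + 1)))
  ext x y
  have hN : 2 * 2 ^ k = 2 ^ (k + 1) := by ring
  simp only [twiddle, tensorChain, Matrix.of_apply, hN]
  by_cases hxy : x = y
  · subst hxy
    simp only [Lmat, Matrix.diagonal_apply_eq, Nat.add_sub_cancel]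
    rw [prod_bits_aux, Nat.mod_eq_of_lt x.isLt]
  · rw [Matrix.diagonal_apply_ne _ hxy]
    symm
    by_contra hne
    apply hxy
    have h : ∀ j < k, bit j x.val = bit j y.val := by
      intro j hj
      by_contra hb
      exact hne (Finset.prod_eq_zero (Finset.mem_range.mpr hj)
        (Matrix.diagonal_apply_ne _ hb))
    have := mod_eq_of_bits_aux _ _ k h
    rw [Nat.mod_eq_of_lt x.isLt, Nat.mod_eq_of_lt y.isLt] at this
    exact Fin.ext this
end

section
/- Let n ≥ 1 and N = 2^n. Define the 2N×2N matrix T_N on standard basis vectors e_{bN+x} (b ∈ {0,1}, 0 ≤ x < N) by: T_N e_0 = e_0, T_N e_N = e_N, T_N e_x = (1/√2)(e_x + e_{2N−x}) and T_N e_{N+x} = (i/√2)(e_x − e_{2N−x}) for 1 ≤ x ≤ N−1. Then T_N^† · F_{2N} · T_N = C_N^I ⊕ (i·S_N^I), the block-diagonal matrix with (N+1)×(N+1) block C_N^I and (N−1)×(N−1) block i·S_N^I. -/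
open Matrix Complex

/-- The discrete Fourier transform matrix `F_M = (1/√M)·[exp(2πi·jk/M)]`. -/
noncomputable def dft (M : ℕ) : Matrix (Fin M) (Fin M) ℂ :=
  Matrix.of fun j k =>
    (1 / (Real.sqrt M : ℂ)) *
      Complex.exp (2 * (Real.pi : ℂ) * Complex.I * ((j.val : ℂ) * (k.val : ℂ)) / (M : ℂ))

/-- The 2N×2N base-change matrix `T_N`, defined on standard basis vectors by
`T_N e_0 = e_0`, `T_N e_N = e_N`, `T_N e_x = (1/√2)(e_x + e_{2N−x})` and
`T_N e_{N+x} = (i/√2)(e_x − e_{2N−x})` for `1 ≤ x ≤ N−1`.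
(The `(i,j)` entry is the coefficient of `e_i` in `T_N e_j`.) -/
noncomputable def Tmat (N : ℕ) : Matrix (Fin (2 * N)) (Fin (2 * N)) ℂ :=
  Matrix.of fun i j =>
    if j.val = 0 then (if i.val = 0 then 1 else 0)
    else if j.val = N then (if i.val = N then 1 else 0)
    else if j.val < N then
      (if i.val = j.val then (1 / (Real.sqrt 2 : ℂ)) else 0) +
      (if i.val = 2 * N - j.val then (1 / (Real.sqrt 2 : ℂ)) else 0)
    else
      (if i.val = j.val - N then Complex.I / (Real.sqrt 2 : ℂ) else 0) +
      (if i.val = 2 * N - (j.val - N) then -(Complex.I / (Real.sqrt 2 : ℂ)) else 0)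

/-- The boundary scaling factors `k_0 = k_N = 1/√2`, `k_i = 1` for `1 ≤ i ≤ N−1`. -/
noncomputable def kfac (N i : ℕ) : ℝ :=
  if i = 0 ∨ i = N then 1 / Real.sqrt 2 else 1

/-- The block-diagonal matrix `C_N^I ⊕ (i·S_N^I)` on `Fin (2*N)`: the first diagonal block
is the `(N+1)×(N+1)` discrete Cosine transform of type I,
`C_N^I = √(2/N)·[k_i k_j cos(ijπ/N)]_{i,j=0,…,N}`, and the second diagonal block
(occupying rows and columns `N+1,…,2N−1`, with `S_N^I` indexed by `i,j = 1,…,N−1`) is `i`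
times the `(N−1)×(N−1)` discrete Sine transform of type I,
`S_N^I = √(2/N)·[sin(ijπ/N)]_{i,j=1,…,N−1}`. -/
noncomputable def dctIdstI (N : ℕ) : Matrix (Fin (2 * N)) (Fin (2 * N)) ℂ :=
  Matrix.of fun i j =>
    if i.val ≤ N ∧ j.val ≤ N then
      ((Real.sqrt (2 / N) * kfac N i.val * kfac N j.val *
        Real.cos (i.val * j.val * Real.pi / N) : ℝ) : ℂ)
    else if N < i.val ∧ N < j.val then
      Complex.I *
        ((Real.sqrt (2 / N) *
          Real.sin ((i.val - N) * (j.val - N) * Real.pi / N) : ℝ) : ℂ)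
    else 0

-- HELPERS
/-- Reflection of an index modulo `2N`. -/
def refl2 (N x : ℕ) : ℕ := if x = 0 then 0 else 2 * N - x

/-- The first basis index occurring in column `j`. -/
def pidx (N j : ℕ) : ℕ := if j ≤ N then j else j - N

/-- The coefficient of column `j`. -/
noncomputable def acoef (N j : ℕ) : ℂ :=
  if j ≤ N then ((kfac N j / Real.sqrt 2 : ℝ) : ℂ) else Complex.I / (Real.sqrt 2 : ℂ)

/-- The relative sign in column `j`. -/
noncomputable def scoef (N j : ℕ) : ℂ := if j ≤ N then 1 else -1

/-- The exponential kernel. -/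
noncomputable def ker2 (N a b : ℕ) : ℂ :=
  Complex.exp ((Real.pi : ℂ) * Complex.I * ((a : ℂ) * (b : ℂ)) / (N : ℂ))

lemma sqrt2_half : (1 / Real.sqrt 2 / Real.sqrt 2 : ℝ) = 1 / 2 := by
  rw [div_div, Real.mul_self_sqrt (by norm_num)]

lemma sqrt2_half_c : ((Real.sqrt 2 : ℂ)⁻¹ / (Real.sqrt 2 : ℂ) : ℂ) = 1 / 2 := by
  have h := congrArg (fun x : ℝ => (x : ℂ)) sqrt2_half
  simpa using h

lemma Tmat_eq (N : ℕ) (hN : 1 ≤ N) (i j : Fin (2 * N)) :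
    Tmat N i j = acoef N j.val * ((if i.val = pidx N j.val then 1 else 0) +
      scoef N j.val * (if i.val = refl2 N (pidx N j.val) then 1 else 0)) := by
  obtain ⟨i, hi⟩ := i
  obtain ⟨j, hj⟩ := j
  simp only [Tmat, Matrix.of_apply, acoef, scoef, pidx]
  by_cases h0 : j = 0
  · subst h0
    simp only [refl2, kfac]
    split_ifs <;> simp_all
    linear_combination (-2 : ℂ) * sqrt2_half_c
  by_cases h1 : j = N
  · subst h1
    have : 2 * j - j = j := by omega
    simp only [refl2, kfac]
    split_ifs <;> simp_all
    linear_combination (-2 : ℂ) * sqrt2_half_c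
  by_cases h2 : j < N
  · have h3 : j ≤ N := h2.le
    simp only [h0, h1, h2, h3, refl2, kfac, if_true, if_false, or_self]
    split_ifs <;> simp <;> ring
  · have h3 : ¬ j ≤ N := by omega
    have h4 : ¬ (j - N = 0) := by omega
    simp only [h0, h1, h2, h3, h4, refl2, if_false]
    split_ifs <;> ring

lemma pidx_lt (N : ℕ) (hN : 1 ≤ N) (j : ℕ) (hj : j < 2 * N) : pidx N j < 2 * N := by
  unfold pidx; split_ifs <;> omega

lemma refl2_lt (N : ℕ) (hN : 1 ≤ N) (x : ℕ) : refl2 N x < 2 * N := by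
  unfold refl2; split_ifs <;> omega

lemma sum_delta (M p : ℕ) (hp : p < M) (f : ℕ → ℂ) :
    ∑ i : Fin M, f i.val * (if i.val = p then 1 else 0) = f p := by
  rw [Finset.sum_eq_single (⟨p, hp⟩ : Fin M)]
  · simp
  · intro b _ hb
    have : b.val ≠ p := fun h => hb (Fin.ext h)
    simp [this]
  · simp

lemma sum_T (N : ℕ) (hN : 1 ≤ N) (j : Fin (2 * N)) (f : ℕ → ℂ) :
    ∑ i : Fin (2 * N), f i.val * Tmat N i j =
      acoef N j.val * (f (pidx N j.val) + scoef N j.val * f (refl2 N (pidx N j.val))) := by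
  have h1 := sum_delta (2 * N) _ (pidx_lt N hN j.val j.isLt) f
  have h2 := sum_delta (2 * N) _ (refl2_lt N hN (pidx N j.val)) f
  rw [← h1, ← h2, Finset.mul_sum, ← Finset.sum_add_distrib, Finset.mul_sum]
  refine Finset.sum_congr rfl fun i _ => ?_
  rw [Tmat_eq N hN]
  ring

lemma sum_T_star (N : ℕ) (hN : 1 ≤ N) (j : Fin (2 * N)) (f : ℕ → ℂ) :
    ∑ i : Fin (2 * N), star (Tmat N i j) * f i.val =
      star (acoef N j.val) *
        (f (pidx N j.val) + scoef N j.val * f (refl2 N (pidx N j.val))) := by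
  have h := congrArg star (sum_T N hN j (fun k => star (f k)))
  have hs : star (scoef N j.val) = scoef N j.val := by
    unfold scoef; split_ifs <;> simp
  simp only [star_sum, star_mul', star_add, star_star, hs] at h
  rw [← h]
  exact Finset.sum_congr rfl fun i _ => mul_comm _ _

lemma dft_eq (N : ℕ) (hN : 1 ≤ N) (i j : Fin (2 * N)) :
    dft (2 * N) i j = (1 / (Real.sqrt ((2 * N : ℕ) : ℝ) : ℂ)) * ker2 N i.val j.val := by
  have : (N : ℂ) ≠ 0 := by exact_mod_cast (by omega : N ≠ 0)
  simp only [dft, ker2, Matrix.of_apply]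
  congr 2
  push_cast
  field_simp

lemma ker2_comm (N a b : ℕ) : ker2 N a b = ker2 N b a := by
  unfold ker2; rw [mul_comm (a : ℂ)]

lemma ker2_refl (N : ℕ) (hN : 1 ≤ N) (a b : ℕ) (ha : a < 2 * N) :
    ker2 N (refl2 N a) b = (ker2 N a b)⁻¹ := by
  have hN0 : (N : ℂ) ≠ 0 := by exact_mod_cast (by omega : N ≠ 0)
  unfold refl2
  split_ifs with h
  · subst h; simp [ker2]
  · unfold ker2
    rw [← Complex.exp_neg, Complex.exp_eq_exp_iff_exists_int]
    refine ⟨b, ?_⟩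
    rw [Nat.cast_sub ha.le]
    push_cast
    field_simp
    ring

lemma ker2_eq (N a b : ℕ) : ker2 N a b =
    (Real.cos (a * b * Real.pi / N) : ℂ) + (Real.sin (a * b * Real.pi / N) : ℂ) * Complex.I := by
  unfold ker2
  push_cast
  rw [← Complex.exp_mul_I]
  congr 1
  ring

lemma ker2_inv_eq (N a b : ℕ) : (ker2 N a b)⁻¹ =
    (Real.cos (a * b * Real.pi / N) : ℂ) - (Real.sin (a * b * Real.pi / N) : ℂ) * Complex.I := by
  unfold ker2
  rw [← Complex.exp_neg]
  push_cast
  rw [Complex.cos, Complex.sin]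
  have e : -((Real.pi : ℂ) * Complex.I * ((a : ℂ) * (b : ℂ)) / (N : ℂ)) =
    -((a : ℂ) * b * Real.pi / N) * Complex.I := by ring
  rw [e]
  linear_combination (1 / 2 * (Complex.exp (-((a : ℂ) * b * Real.pi / N) * Complex.I) -
    Complex.exp (((a : ℂ) * b * Real.pi / N) * Complex.I))) * Complex.I_sq

lemma sqrt_const (N : ℕ) (hN : 1 ≤ N) :
    (1 / (Real.sqrt ((2 * N : ℕ) : ℝ) : ℂ)) * 2 = ((Real.sqrt (2 / N) : ℝ) : ℂ) := by
  have h : (1 / (Real.sqrt ((2 * N : ℕ) : ℝ))) * 2 = Real.sqrt (2 / N) := by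
    have hN' : (0 : ℝ) < N := by exact_mod_cast hN
    symm
    rw [Real.sqrt_eq_iff_mul_self_eq (by positivity) (by positivity)]
    have hs : Real.sqrt ((2 * N : ℕ) : ℝ) ^ 2 = 2 * N := by
      rw [Real.sq_sqrt (by positivity)]; push_cast; ring
    have : (1 / (Real.sqrt ((2 * N : ℕ) : ℝ))) * 2 * ((1 / (Real.sqrt ((2 * N : ℕ) : ℝ))) * 2) =
      4 / Real.sqrt ((2 * N : ℕ) : ℝ) ^ 2 := by ring
    rw [this, hs]
    field_simp
    norm_num
  rw [← h]
  push_cast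
  ring

lemma main_entry (N : ℕ) (hN : 1 ≤ N) (i j : Fin (2 * N)) :
    ((Tmat N)ᴴ * dft (2 * N) * Tmat N) i j =
      star (acoef N i.val) * acoef N j.val * (1 / (Real.sqrt ((2 * N : ℕ) : ℝ) : ℂ)) *
      ((1 + scoef N i.val * scoef N j.val) * ker2 N (pidx N i.val) (pidx N j.val) +
       (scoef N i.val + scoef N j.val) * (ker2 N (pidx N i.val) (pidx N j.val))⁻¹) := by
  have hi := pidx_lt N hN i.val i.isLt
  have hj := pidx_lt N hN j.val j.isLt
  have inner : ∀ k : Fin (2 * N), ((Tmat N)ᴴ * dft (2 * N)) i k =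
      (fun k => star (acoef N i.val) * ((1 / (Real.sqrt ((2 * N : ℕ) : ℝ) : ℂ)) *
        ker2 N (pidx N i.val) k + scoef N i.val * ((1 / (Real.sqrt ((2 * N : ℕ) : ℝ) : ℂ)) *
        ker2 N (refl2 N (pidx N i.val)) k))) k.val := by
    intro k
    have := sum_T_star N hN i (fun a => (1 / (Real.sqrt ((2 * N : ℕ) : ℝ) : ℂ)) * ker2 N a k.val)
    refine Eq.trans ?_ this
    rw [Matrix.mul_apply]
    refine Finset.sum_congr rfl fun a _ => ?_
    rw [dft_eq N hN, Matrix.conjTranspose_apply]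
  rw [Matrix.mul_apply]
  refine (Finset.sum_congr rfl fun k _ => congrArg (· * Tmat N k j) (inner k)).trans ((sum_T N hN j
    (fun k => star (acoef N i.val) * ((1 / (Real.sqrt ((2 * N : ℕ) : ℝ) : ℂ)) *
        ker2 N (pidx N i.val) k + scoef N i.val * ((1 / (Real.sqrt ((2 * N : ℕ) : ℝ) : ℂ)) *
        ker2 N (refl2 N (pidx N i.val)) k)))).trans ?_)
  beta_reduce
  rw [ker2_refl N hN _ (pidx N j.val) hi, ker2_refl N hN _ (refl2 N _) hi,
    ker2_comm N _ (refl2 N _), ker2_refl N hN _ _ hj, ker2_comm N (pidx N j.val), inv_inv]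
  ring

/-- For `N = 2^n`, `n ≥ 1`: `T_N† · F_{2N} · T_N = C_N^I ⊕ (i·S_N^I)`. -/
theorem dctI_dstI_from_dft (n N : ℕ) (hn : 1 ≤ n) (hN : N = 2 ^ n) :
    (Tmat N)ᴴ * dft (2 * N) * Tmat N = dctIdstI N := by
  have hN1 : 1 ≤ N := by rw [hN]; exact Nat.one_le_two_pow
  have h2 : (Real.sqrt 2 : ℂ)⁻¹ ^ 2 = 1 / 2 := by
    rw [inv_pow, ← Complex.ofReal_pow, Real.sq_sqrt (by norm_num)]
    norm_num
  ext i j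
  rw [main_entry N hN1, ker2_inv_eq, ker2_eq]
  simp only [dctIdstI, Matrix.of_apply]
  by_cases hi : i.val ≤ N <;> by_cases hj : j.val ≤ N
  · simp only [acoef, scoef, pidx, hi, hj, and_self, if_true, Complex.star_def,
      Complex.conj_ofReal]
    rw [Complex.ofReal_mul, Complex.ofReal_mul, Complex.ofReal_mul, ← sqrt_const N hN1,
      Complex.ofReal_div, Complex.ofReal_div]
    simp only [div_eq_mul_inv]
    linear_combination ((kfac N i.val : ℂ) * (kfac N j.val : ℂ) *
      (1 * (Real.sqrt ((2 * N : ℕ) : ℝ) : ℂ)⁻¹) * 4 *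
      (Real.cos (i.val * j.val * Real.pi * (N : ℝ)⁻¹) : ℂ)) * h2
  · simp [scoef, hi, hj]
  · simp [scoef, hi, hj]
  · have hi' : N < i.val := by omega
    have hj' : N < j.val := by omega
    simp only [acoef, scoef, pidx, hi, hj, hi', hj', and_self, if_true, if_false,
      Complex.star_def, map_div₀, Complex.conj_ofReal, Complex.conj_I]
    rw [Complex.ofReal_mul, ← sqrt_const N hN1, Nat.cast_sub hi'.le, Nat.cast_sub hj'.le]
    simp only [div_eq_mul_inv]
    generalize (Real.sin _ : ℂ) = s
    generalize (Real.cos _ : ℂ) = c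
    linear_combination (-Complex.I ^ 3 * (1 * (Real.sqrt ((2 * N : ℕ) : ℝ) : ℂ)⁻¹) * 4 * s) * h2
      - (2 * Complex.I * (1 * (Real.sqrt ((2 * N : ℕ) : ℝ) : ℂ)⁻¹) * s) * Complex.I_sq
end

section
/- Let n ≥ 1 and N = 2^n. Define 2N×2N matrices as follows: T_N acts on standard basis vectors e_{bN+x} (b ∈ {0,1}, 0 ≤ x < N) by T_N e_0 = e_0, T_N e_N = e_N, T_N e_x = (1/√2)(e_x + e_{2N−x}), T_N e_{N+x} = (i/√2)(e_x − e_{2N−x}) for 1 ≤ x ≤ N−1; D acts by D e_0 = e_0, D e_N = e_N, D e_x = (1/√2)(e_x + e_{N+x}), D e_{N+x} = (i/√2)(e_x − e_{N+x}) for 1 ≤ x ≤ N−1; and π is the permutation matrix with π e_x = e_x for 0 ≤ x < N, π e_N = e_N, and π e_{N+x} = e_{N+(N−x)} for 1 ≤ x ≤ N−1 (the two's complement conditioned on the most significant bit). Then T_N = π · D. -/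
open Matrix Complex

/-- The 2N×2N operator `D`, defined on standard basis vectors by `D e_0 = e_0`,
`D e_N = e_N`, `D e_x = (1/√2)(e_x + e_{N+x})` and `D e_{N+x} = (i/√2)(e_x − e_{N+x})`
for `1 ≤ x ≤ N−1`. -/
noncomputable def Dmat (N : ℕ) : Matrix (Fin (2 * N)) (Fin (2 * N)) ℂ :=
  Matrix.of fun i j =>
    if j.val = 0 then (if i.val = 0 then 1 else 0)
    else if j.val = N then (if i.val = N then 1 else 0)
    else if j.val < N then
      (if i.val = j.val then (1 / (Real.sqrt 2 : ℂ)) else 0) +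
      (if i.val = N + j.val then (1 / (Real.sqrt 2 : ℂ)) else 0)
    else
      (if i.val = j.val - N then Complex.I / (Real.sqrt 2 : ℂ) else 0) +
      (if i.val = j.val then -(Complex.I / (Real.sqrt 2 : ℂ)) else 0)

/-- The permutation matrix `π` (two's complement conditioned on the most significant bit):
`π e_x = e_x` for `0 ≤ x < N`, `π e_N = e_N`, and `π e_{N+x} = e_{N+(N−x)}` for
`1 ≤ x ≤ N−1`. -/
noncomputable def piMat (N : ℕ) : Matrix (Fin (2 * N)) (Fin (2 * N)) ℂ :=
  Matrix.of fun i j =>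
    if j.val ≤ N then (if i.val = j.val then 1 else 0)
    else (if i.val = N + (N - (j.val - N)) then 1 else 0)

/-- For `N = 2^n`, `n ≥ 1`: the base-change matrix factors as `T_N = π · D`. -/
theorem Tmat_eq_pi_mul_D (n N : ℕ) (hn : 1 ≤ n) (hN : N = 2 ^ n) :
    Tmat N = piMat N * Dmat N := by
  have hN0 : 0 < N := by rw [hN]; positivity
  clear hN hn
  ext i j
  have hi := i.isLt
  have hj := j.isLt
  obtain ⟨s, hs⟩ : ∃ s : Fin (2 * N), s.val = if i.val ≤ N then i.val else 3 * N - i.val := by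
    refine ⟨⟨if i.val ≤ N then i.val else 3 * N - i.val, ?_⟩, rfl⟩
    split_ifs <;> omega
  have hpi : ∀ k : Fin (2 * N), piMat N i k = if k = s then 1 else 0 := by
    intro k
    have hk := k.isLt
    simp only [piMat, Matrix.of_apply, Fin.ext_iff, hs]
    split_ifs <;> first | rfl | (exfalso; omega)
  rw [Matrix.mul_apply]
  simp only [hpi, ite_mul, one_mul, zero_mul, Finset.sum_ite_eq', Finset.sum_ite_eq,
    Finset.mem_univ, if_true]
  simp only [Tmat, Dmat, Matrix.of_apply]
  by_cases h : i.val ≤ N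
  · rw [if_pos h] at hs
    rw [hs]
    split_ifs <;> first | rfl | (exfalso; omega)
  · rw [if_neg h] at hs
    rw [hs]
    split_ifs <;> first | rfl | (exfalso; omega)
end

section
/- Let n ≥ 1, N = 2^n, and ω = exp(2πi/4N). Define the 2N×2N matrix R_N by: for 0 ≤ j ≤ N−1, the j-th column is (1/√2)(ω^j e_j + \overline{ω}^{j+N}·(−i)·… ); explicitly, R_N = (1/√2) times the matrix whose entries are: R_N[j,j] = ω^j and R_N[2N−1−j, j] = \overline{ω}^{j+1} for 0 ≤ j ≤ N−1, R_N[j, N+j] = −i·ω^j and R_N[2N−1−j, N+j] = i·\overline{ω}^{j+1} for 0 ≤ j ≤ N−1, and all other entries zero. Then e^{πi/4N} · R_N^t · F_{2N} · R_N = C_N^{IV} ⊕ ((−i)·S_N^{IV}), the block-diagonal matrix with N×N blocks C_N^{IV} and (−i)·S_N^{IV}. -/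
open Matrix Complex

/-- The primitive `4N`-th root of unity `ω = exp(2πi/4N)`. -/
noncomputable def om (N : ℕ) : ℂ :=
  Complex.exp (2 * (Real.pi : ℂ) * Complex.I / ((4 * N : ℕ) : ℂ))

/-- The 2N×2N base-change matrix `R_N`: for `0 ≤ j ≤ N−1` its nonzero entries are
`R_N[j,j] = ω^j/√2`, `R_N[2N−1−j, j] = ω̄^(j+1)/√2`, `R_N[j, N+j] = −i·ω^j/√2`,
`R_N[2N−1−j, N+j] = i·ω̄^(j+1)/√2`, where `ω = exp(2πi/4N)`. -/
noncomputable def Rmat (N : ℕ) : Matrix (Fin (2 * N)) (Fin (2 * N)) ℂ :=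
  Matrix.of fun i c =>
    if c.val < N then
      (if i.val = c.val then om N ^ c.val / (Real.sqrt 2 : ℂ) else 0) +
      (if i.val = 2 * N - 1 - c.val then
        (starRingEnd ℂ (om N)) ^ (c.val + 1) / (Real.sqrt 2 : ℂ) else 0)
    else
      (if i.val = c.val - N then -Complex.I * om N ^ (c.val - N) / (Real.sqrt 2 : ℂ) else 0) +
      (if i.val = 2 * N - 1 - (c.val - N) then
        Complex.I * (starRingEnd ℂ (om N)) ^ (c.val - N + 1) / (Real.sqrt 2 : ℂ) else 0)

/-- The block-diagonal matrix `C_N^IV ⊕ ((−i)·S_N^IV)` on `Fin (2*N)`, where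
`C_N^IV = √(2/N)·[cos((i+1/2)(j+1/2)π/N)]_{i,j=0,…,N−1}` and
`S_N^IV = √(2/N)·[sin((i+1/2)(j+1/2)π/N)]_{i,j=0,…,N−1}`. -/
noncomputable def dctIVdstIV (N : ℕ) : Matrix (Fin (2 * N)) (Fin (2 * N)) ℂ :=
  Matrix.of fun i j =>
    if i.val < N ∧ j.val < N then
      ((Real.sqrt (2 / N) *
        Real.cos ((i.val + 1 / 2) * (j.val + 1 / 2) * Real.pi / N) : ℝ) : ℂ)
    else if N ≤ i.val ∧ N ≤ j.val then
      -Complex.I *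
        ((Real.sqrt (2 / N) *
          Real.sin (((i.val - N : ℕ) + 1 / 2) * ((j.val - N : ℕ) + 1 / 2) * Real.pi / N) : ℝ) : ℂ)
    else 0


lemma aux_om_pow (N j : ℕ) : om N ^ j =
    Complex.exp (2 * (Real.pi : ℂ) * Complex.I * (j : ℂ) / ((4 * N : ℕ) : ℂ)) := by
  rw [om, ← Complex.exp_nat_mul]
  congr 1
  ring

lemma aux_om_conj_pow (N j : ℕ) : (starRingEnd ℂ (om N)) ^ j =
    Complex.exp (-(2 * (Real.pi : ℂ) * Complex.I * (j : ℂ) / ((4 * N : ℕ) : ℂ))) := by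
  rw [om, ← Complex.exp_conj, ← Complex.exp_nat_mul]
  congr 1
  simp only [map_div₀, map_mul, Complex.conj_I, Complex.conj_ofReal, map_natCast, map_ofNat]
  ring

/-- The index attached to a column. -/
def auxIdx (N c : ℕ) : ℕ := if c < N then c else c - N

/-- The coefficient at the top. -/
noncomputable def auxA (N c : ℕ) : ℂ := if c < N then 1 else -Complex.I

/-- The coefficient at the bottom. -/
noncomputable def auxB (N c : ℕ) : ℂ := if c < N then 1 else Complex.I

lemma auxIdx_lt (N : ℕ) (c : Fin (2 * N)) : auxIdx N c < N := by
  have := c.2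
  unfold auxIdx
  split_ifs <;> omega

lemma aux_R (N : ℕ) (i c : Fin (2 * N)) (p q : Fin (2 * N))
    (hp : p.val = auxIdx N c) (hq : q.val = 2 * N - 1 - auxIdx N c) :
    Rmat N i c =
      (if i = p then auxA N c * om N ^ (auxIdx N c) / (Real.sqrt 2 : ℂ) else 0) +
      (if i = q then auxB N c * (starRingEnd ℂ (om N)) ^ (auxIdx N c + 1) / (Real.sqrt 2 : ℂ)
        else 0) := by
  simp only [Fin.ext_iff, hp, hq]
  unfold Rmat auxIdx auxA auxB
  simp only [Matrix.of_apply]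
  split_ifs <;> simp

lemma aux_sum (N : ℕ) (i k : Fin (2 * N)) (p q p' q' : Fin (2 * N))
    (hp : p.val = auxIdx N i) (hq : q.val = 2 * N - 1 - auxIdx N i)
    (hp' : p'.val = auxIdx N k) (hq' : q'.val = 2 * N - 1 - auxIdx N k)
    (F : Matrix (Fin (2 * N)) (Fin (2 * N)) ℂ) :
    ((Rmat N)ᵀ * F * Rmat N) i k =
      ((auxA N i * om N ^ (auxIdx N i) * F p p' +
        auxB N i * (starRingEnd ℂ (om N)) ^ (auxIdx N i + 1) * F q p') *
          (auxA N k * om N ^ (auxIdx N k)) +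
      (auxA N i * om N ^ (auxIdx N i) * F p q' +
        auxB N i * (starRingEnd ℂ (om N)) ^ (auxIdx N i + 1) * F q q') *
          (auxB N k * (starRingEnd ℂ (om N)) ^ (auxIdx N k + 1))) / 2 := by
  have h2 : (Real.sqrt 2 : ℂ) ^ 2 = 2 := by
    norm_cast
    simp
  simp only [Matrix.mul_apply, Matrix.transpose_apply, aux_R N _ i p q hp hq,
    aux_R N _ k p' q' hp' hq', add_mul, mul_add, Finset.sum_add_distrib, ite_mul, mul_ite,
    zero_mul, mul_zero, Finset.sum_ite_eq', Finset.mem_univ, if_true]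
  rw [← h2]
  ring

lemma aux_exp (x y : ℂ) (n : ℤ) (h : x = y + n * (2 * (Real.pi : ℂ) * Complex.I)) :
    Complex.exp x = Complex.exp y :=
  Complex.exp_eq_exp_iff_exists_int.2 ⟨n, h⟩

lemma aux_main (N : ℕ) (hN : 0 < N) (i k : Fin (2 * N)) (θ : ℂ)
    (hθ : θ = ((auxIdx N i : ℂ) + 1 / 2) * ((auxIdx N k : ℂ) + 1 / 2) * Real.pi / N) :
    Complex.exp ((Real.pi : ℂ) * Complex.I / ((4 * N : ℕ) : ℂ)) *
      ((Rmat N)ᵀ * dft (2 * N) * Rmat N) i k =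
    1 / (Real.sqrt (2 * N : ℕ) : ℂ) / 2 *
      ((auxA N i * auxA N k + auxB N i * auxB N k) * Complex.exp (θ * Complex.I) +
       (auxA N i * auxB N k + auxB N i * auxA N k) * Complex.exp (-θ * Complex.I)) := by
  have hi := auxIdx_lt N i
  have hk := auxIdx_lt N k
  have hN' : (N : ℂ) ≠ 0 := by exact_mod_cast hN.ne'
  rw [aux_sum N i k ⟨auxIdx N i, by omega⟩ ⟨2 * N - 1 - auxIdx N i, by omega⟩
    ⟨auxIdx N k, by omega⟩ ⟨2 * N - 1 - auxIdx N k, by omega⟩ rfl rfl rfl rfl]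
  simp only [dft, Matrix.of_apply, aux_om_pow, aux_om_conj_pow]
  generalize auxIdx N i = j at *
  generalize auxIdx N k = l at *
  have cj : ((2 * N - 1 - j : ℕ) : ℂ) = 2 * N - 1 - j := by
    rw [Nat.cast_sub (by omega), Nat.cast_sub (by omega)]; push_cast; ring
  have cl : ((2 * N - 1 - l : ℕ) : ℂ) = 2 * N - 1 - l := by
    rw [Nat.cast_sub (by omega), Nat.cast_sub (by omega)]; push_cast; ring
  rw [cj, cl]
  push_cast
  set P : ℂ := (Real.pi : ℂ)
  have e1 : Complex.exp (P * I / (4 * N)) * Complex.exp (2 * P * I * j / (4 * N)) *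
      Complex.exp (2 * P * I * (j * l) / (2 * N)) * Complex.exp (2 * P * I * l / (4 * N)) =
      Complex.exp (θ * I) := by
    simp only [← Complex.exp_add]
    apply aux_exp _ _ 0
    rw [hθ]; push_cast; field_simp; ring
  have e2 : Complex.exp (P * I / (4 * N)) * Complex.exp (2 * P * I * j / (4 * N)) *
      Complex.exp (2 * P * I * (j * (2 * N - 1 - l)) / (2 * N)) *
        Complex.exp (-(2 * P * I * (l + 1) / (4 * N))) =
      Complex.exp (-θ * I) := by
    simp only [← Complex.exp_add]
    apply aux_exp _ _ j
    rw [hθ]; push_cast; field_simp; ring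
  have e3 : Complex.exp (P * I / (4 * N)) * Complex.exp (-(2 * P * I * (j + 1) / (4 * N))) *
      Complex.exp (2 * P * I * ((2 * N - 1 - j) * l) / (2 * N)) *
        Complex.exp (2 * P * I * l / (4 * N)) =
      Complex.exp (-θ * I) := by
    simp only [← Complex.exp_add]
    apply aux_exp _ _ l
    rw [hθ]; push_cast; field_simp; ring
  have e4 : Complex.exp (P * I / (4 * N)) * Complex.exp (-(2 * P * I * (j + 1) / (4 * N))) *
      Complex.exp (2 * P * I * ((2 * N - 1 - j) * (2 * N - 1 - l)) / (2 * N)) *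
        Complex.exp (-(2 * P * I * (l + 1) / (4 * N))) =
      Complex.exp (θ * I) := by
    simp only [← Complex.exp_add]
    apply aux_exp _ _ (2 * N - 2 - j - l)
    rw [hθ]; push_cast; field_simp; ring
  generalize (1 : ℂ) / (Real.sqrt (2 * N) : ℂ) = s
  linear_combination (s / 2 * auxA N i * auxA N k) * e1 + (s / 2 * auxA N i * auxB N k) * e2 +
    (s / 2 * auxB N i * auxA N k) * e3 + (s / 2 * auxB N i * auxB N k) * e4

lemma aux_sqrt (N : ℕ) (hN : 0 < N) :
    ((Real.sqrt (2 / N) : ℝ) : ℂ) = 2 * (1 / (Real.sqrt (2 * N : ℕ) : ℂ)) := by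
  have h : Real.sqrt (2 / N) = 2 * (1 / Real.sqrt (2 * N : ℕ)) := by
    have hN' : (0 : ℝ) < N := by exact_mod_cast hN
    push_cast
    rw [Real.sqrt_eq_iff_mul_self_eq (by positivity) (by positivity)]
    have h3 : Real.sqrt (2 * N) ^ 2 = 2 * N := Real.sq_sqrt (by positivity)
    have h4 : Real.sqrt (2 * N) ≠ 0 := by positivity
    field_simp
    rw [h3]
  rw [h]
  push_cast
  ring

/-- For `N = 2^n`, `n ≥ 1`:
`e^{πi/4N} · R_N^t · F_{2N} · R_N = C_N^IV ⊕ ((−i)·S_N^IV)`. -/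
theorem dctIV_dstIV_from_dft (n N : ℕ) (hn : 1 ≤ n) (hN : N = 2 ^ n) :
    Complex.exp ((Real.pi : ℂ) * Complex.I / ((4 * N : ℕ) : ℂ)) •
      ((Rmat N)ᵀ * dft (2 * N) * Rmat N) = dctIVdstIV N := by
  have hpos : 0 < N := by rw [hN]; positivity
  ext i k
  rw [Matrix.smul_apply, smul_eq_mul, aux_main N hpos i k _ rfl]
  unfold dctIVdstIV
  rw [Matrix.of_apply]
  simp only [Complex.ofReal_mul, aux_sqrt N hpos, Complex.ofReal_cos, Complex.ofReal_sin]
  generalize (1 : ℂ) / (Real.sqrt (2 * N : ℕ) : ℂ) = s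
  by_cases hi : i.val < N <;> by_cases hk : k.val < N
  · simp only [auxA, auxB, auxIdx, hi, hk, and_self, if_true]
    push_cast
    rw [Complex.cos]
    ring
  · simp only [auxA, auxB, auxIdx, hi, hk, and_false, if_true, if_false, not_le.2 hi, false_and]
    ring
  · simp only [auxA, auxB, auxIdx, hi, hk, and_false, if_true, if_false, not_le.2 hk, false_and]
    ring
  · simp only [auxA, auxB, auxIdx, hi, hk, if_true, if_false, not_lt.1 hi, not_lt.1 hk,
      and_self]
    push_cast
    rw [Complex.sin]
    ring_nf
end

section
/- Let n ≥ 1, N = 2^n, and ω = exp(2πi/4N). Define the following 2N×2N matrices: U_N acting on standard basis vectors by U_N e_0 = e_0, U_N e_x = (\overline{ω}^x/√2)·e_x + (ω^x/√2)·e_{N+(N−x)} for 1 ≤ x ≤ N−1, U_N e_{2N−1} = −e_N, and U_N e_{N+y} = −(i\overline{ω}^{y+1}/√2)·e_{y+1} + (iω^{y+1}/√2)·e_{N+(N−1−y)} for 0 ≤ y ≤ N−2; the diagonal matrix D_1 = diag(1, ω, …, ω^{N−1}, \overline{ω}^N, …, \overline{ω}^2, \overline{ω}); T̄_N, the entrywise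 complex conjugate of the matrix T_N given by T_N e_0 = e_0, T_N e_N = e_N, T_N e_x = (1/√2)(e_x + e_{2N−x}), T_N e_{N+x} = (i/√2)(e_x − e_{2N−x}) for 1 ≤ x ≤ N−1; the diagonal matrix D_0 with D_0 e_N = i·e_N and D_0 e_j = e_j for j ≠ N; and the permutation matrix π_2 with π_2 e_x = e_x and π_2 e_{N+x} = e_{N+((x+1) mod 2^n)} for 0 ≤ x < N. Then U_N = D_1^† · T̄_N · D_0 · π_2. -/
open Matrix Complex

/-- The 2N×2N matrix `U_N`, defined on standard basis vectors by `U_N e_0 = e_0`;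
`U_N e_x = (ω̄^x/√2)·e_x + (ω^x/√2)·e_{N+(N−x)}` for `1 ≤ x ≤ N−1`; `U_N e_{2N−1} = −e_N`;
and `U_N e_{N+y} = −(i·ω̄^(y+1)/√2)·e_{y+1} + (i·ω^(y+1)/√2)·e_{N+(N−1−y)}` for
`0 ≤ y ≤ N−2`, where `ω = exp(2πi/4N)`. -/
noncomputable def Umat (N : ℕ) : Matrix (Fin (2 * N)) (Fin (2 * N)) ℂ :=
  Matrix.of fun i c =>
    if c.val = 0 then (if i.val = 0 then 1 else 0)
    else if c.val < N then
      (if i.val = c.val then (starRingEnd ℂ (om N)) ^ c.val / (Real.sqrt 2 : ℂ) else 0) +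
      (if i.val = N + (N - c.val) then om N ^ c.val / (Real.sqrt 2 : ℂ) else 0)
    else if c.val = 2 * N - 1 then (if i.val = N then -1 else 0)
    else
      (if i.val = c.val - N + 1 then
        -(Complex.I * (starRingEnd ℂ (om N)) ^ (c.val - N + 1)) / (Real.sqrt 2 : ℂ) else 0) +
      (if i.val = N + (N - 1 - (c.val - N)) then
        Complex.I * om N ^ (c.val - N + 1) / (Real.sqrt 2 : ℂ) else 0)

/-- The 2N×2N diagonal matrix `D_1 = diag(1, ω, …, ω^{N−1}, ω̄^N, ω̄^{N−1}, …, ω̄^2, ω̄)`. -/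
noncomputable def D1mat (N : ℕ) : Matrix (Fin (2 * N)) (Fin (2 * N)) ℂ :=
  Matrix.diagonal fun j =>
    if j.val < N then om N ^ j.val else (starRingEnd ℂ (om N)) ^ (2 * N - j.val)

/-- The 2N×2N diagonal matrix `D_0` with `D_0 e_N = i·e_N` and `D_0 e_j = e_j` for `j ≠ N`. -/
noncomputable def D0mat (N : ℕ) : Matrix (Fin (2 * N)) (Fin (2 * N)) ℂ :=
  Matrix.diagonal fun j => if j.val = N then Complex.I else 1

/-- The permutation matrix `π_2` (increment modulo `2^n` conditioned on the most significant
bit): `π_2 e_x = e_x` and `π_2 e_{N+x} = e_{N+((x+1) mod N)}` for `0 ≤ x < N`. -/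
noncomputable def pi2Mat (N : ℕ) : Matrix (Fin (2 * N)) (Fin (2 * N)) ℂ :=
  Matrix.of fun i j =>
    if j.val < N then (if i.val = j.val then 1 else 0)
    else (if i.val = N + ((j.val - N + 1) % N) then 1 else 0)

theorem om_pow_self (N : ℕ) (h : 0 < N) : om N ^ N = Complex.I := by
  have hN : (N : ℂ) ≠ 0 := by exact_mod_cast h.ne'
  unfold om
  rw [← Complex.exp_nat_mul]
  have : (N : ℂ) * (2 * (Real.pi : ℂ) * Complex.I / ((4 * N : ℕ) : ℂ))
      = (Real.pi : ℂ) / 2 * Complex.I := by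
    push_cast
    field_simp
    ring
  rw [this, Complex.exp_pi_div_two_mul_I]

theorem prod_pi2 (N : ℕ) (A : Matrix (Fin (2 * N)) (Fin (2 * N)) ℂ)
    (i c k : Fin (2 * N))
    (hk : k.val = if c.val < N then c.val else N + ((c.val - N + 1) % N)) :
    (A * pi2Mat N) i c = A i k := by
  rw [Matrix.mul_apply, Finset.sum_eq_single k]
  · simp only [pi2Mat, Matrix.of_apply]
    split_ifs at hk ⊢ <;> simp_all
  · intro b _ hb
    have hb' : b.val ≠ k.val := fun h => hb (Fin.ext h)
    simp only [pi2Mat, Matrix.of_apply]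
    split_ifs at hk ⊢ <;> simp_all
  · simp

/-- For `N = 2^n`, `n ≥ 1`: `U_N = D_1† · T̄_N · D_0 · π_2`, where `T̄_N` is the entrywise
complex conjugate of `T_N`. -/
theorem Umat_factorization (n N : ℕ) (hn : 1 ≤ n) (hN : N = 2 ^ n) :
    Umat N = (D1mat N)ᴴ * (Tmat N).map (starRingEnd ℂ) * D0mat N * pi2Mat N := by
  have hN2 : 2 ≤ N := by
    rw [hN]
    calc 2 = 2 ^ 1 := rfl
      _ ≤ 2 ^ n := Nat.pow_le_pow_right (by norm_num) hn
  clear hN hn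
  have hI := om_pow_self N (by omega)
  ext i c
  have hi := i.isLt
  have hc := c.isLt
  obtain ⟨k, hk⟩ : ∃ k : Fin (2 * N),
      k.val = if c.val < N then c.val else N + ((c.val - N + 1) % N) := by
    refine ⟨⟨if c.val < N then c.val else N + ((c.val - N + 1) % N), ?_⟩, rfl⟩
    have := Nat.mod_lt (c.val - N + 1) (show 0 < N by omega)
    split_ifs <;> omega
  rw [prod_pi2 N _ i c k hk]
  simp only [D0mat, D1mat, Matrix.mul_diagonal, Matrix.diagonal_conjTranspose,
    Matrix.diagonal_mul, Matrix.map_apply, Tmat, Umat, Matrix.of_apply, Pi.star_apply]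
  generalize i.val = a at *
  generalize c.val = b at *
  generalize k.val = d at *
  by_cases hb : b < N
  · rw [if_pos hb] at hk
    subst hk
    rcases Nat.eq_zero_or_pos d with rfl | hd
    · by_cases ha : a = 0
      · subst ha
        simp [show 0 < N by omega, show (0 : ℕ) ≠ N by omega]
      · simp [ha]
    · by_cases h1 : a = d
      · subst h1
        simp [hd.ne', hb, hb.ne, show a ≠ N + (N - a) by omega, show a ≠ 2 * N - a by omega,
          div_eq_mul_inv]
      · by_cases h2 : a = 2 * N - d
        · have h3 : N + (N - d) = 2 * N - d := by omega
          have h4 : 2 * N - (2 * N - d) = d := by omega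
          subst h2
          simp [hd.ne', hb, hb.ne, h1, h3, h4, show ¬ (2 * N - d < N) by omega,
            div_eq_mul_inv]
        · simp [hd.ne', hb, hb.ne, h1, h2, show a ≠ N + (N - d) by omega]
  · rw [if_neg hb] at hk
    by_cases hl : b = 2 * N - 1
    · have : d = N := by
        rw [hk, hl, show 2 * N - 1 - N + 1 = N by omega, Nat.mod_self, add_zero]
      subst this
      by_cases ha : a = d
      · subst ha
        simp [hb, hl, show 2 * a - 1 ≠ 0 by omega, show ¬ (2 * a - 1 < a) by omega,
          show a ≠ 0 by omega, show 2 * a - a = a by omega, hI]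
      · simp [hb, hl, ha, show 2 * d - 1 ≠ 0 by omega, show ¬ (2 * d - 1 < d) by omega,
          show d ≠ 0 by omega]
    · rw [Nat.mod_eq_of_lt (by omega)] at hk
      obtain ⟨y, hy, rfl⟩ : ∃ y, y < N - 1 ∧ b = N + y := ⟨b - N, by omega, by omega⟩
      have e1 : N + y - N = y := by omega
      have e2 : N + (y + 1) - N = y + 1 := by omega
      rw [e1] at hk
      subst hk
      have f1 : N + y ≠ 0 := by omega
      have f2 : N + (y + 1) ≠ 0 := by omega
      have f3 : N + (y + 1) ≠ N := by omega
      have f4 : ¬ (N + (y + 1) < N) := by omega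
      have f5 : N + (N - 1 - y) = 2 * N - (y + 1) := by omega
      rw [if_neg f1, if_neg hb, if_neg hl, if_neg f2, if_neg f3, if_neg f4, if_neg f3,
        e1, e2, f5]
      by_cases h1 : a = y + 1
      · subst h1
        rw [if_pos rfl, if_neg (by omega), if_pos (by omega), if_pos rfl, if_neg (by omega)]
        simp [div_eq_mul_inv]
        ring
      · by_cases h2 : a = 2 * N - (y + 1)
        · have h4 : 2 * N - (2 * N - (y + 1)) = y + 1 := by omega
          subst h2
          rw [if_neg h1, if_pos rfl, if_neg (by omega), if_neg h1, if_pos rfl, h4]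
          simp [div_eq_mul_inv]
          ring
        · simp [h1, h2]
end

section
/- Let n ≥ 1, N = 2^n, and ω = exp(2πi/4N). With the matrices U_N, D_1, D_0, π_2 defined as follows: U_N e_0 = e_0, U_N e_x = (\overline{ω}^x/√2)·e_x + (ω^x/√2)·e_{N+(N−x)} for 1 ≤ x ≤ N−1, U_N e_{2N−1} = −e_N, U_N e_{N+y} = −(i\overline{ω}^{y+1}/√2)·e_{y+1} + (iω^{y+1}/√2)·e_{N+(N−1−y)} for 0 ≤ y ≤ N−2; D_1 = diag(1, ω, …, ω^{N−1}, \overline{ω}^N, …, \overline{ω}); D_0 e_N = i·e_N and D_0 e_j = e_j for j ≠ N; π_2 e_x = e_x and π_2 e_{N+x} = e_{N+((x+1) mod 2^n)}; and with D given by D e_0 = e_0, D e_N = e_N, D e_x = (1/√2)(e_x + e_{N+x}), D e_{N+x} = (i/√2)(e_x − e_{N+x}) for 1 ≤ x ≤ N−1, and π given by π e_x = e_x for 0 ≤ x < N, π e_N = e_N, π e_{N+x} = e_{N+(N−x)} for 1 ≤ x ≤ N−1, the conjugate transpose of U_N satisfies U_N^† = π_2^{−1} · (D̄_0 · D^t)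 · π^{−1} · D_1, where D̄_0 is the entrywise complex conjugate of D_0 and D^t is the transpose of D. -/
open Matrix Complex

/-- The 0/1 matrix of a self-map `f` of the index set, sending `e_j` to `e_{f j}`. -/
def mapMat {m : ℕ} (f : Fin m → Fin m) : Matrix (Fin m) (Fin m) ℂ :=
  Matrix.of fun i j => if i = f j then 1 else 0

lemma mapMat_inv {m : ℕ} (f : Fin m → Fin m) (hf : Function.Injective f) :
    (mapMat f)⁻¹ = (mapMat f)ᵀ := by
  apply Matrix.inv_eq_left_inv
  ext i j
  simp [mapMat, Matrix.mul_apply, Matrix.one_apply, hf.eq_iff]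
  simp [eq_comm]

lemma mapMat_transpose_mul {m : ℕ} (f : Fin m → Fin m) (A : Matrix (Fin m) (Fin m) ℂ)
    (i j : Fin m) : ((mapMat f)ᵀ * A) i j = A (f i) j := by
  simp [mapMat, Matrix.mul_apply]

lemma mul_mapMat {m : ℕ} (f : Fin m → Fin m) (A : Matrix (Fin m) (Fin m) ℂ)
    (i j : Fin m) : (A * mapMat f) i j = A i (f j) := by
  simp [mapMat, Matrix.mul_apply]

lemma mapMat_inv_of_involutive {m : ℕ} (f : Fin m → Fin m) (hf : Function.Involutive f) :
    (mapMat f)⁻¹ = mapMat f := by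
  apply Matrix.inv_eq_left_inv
  ext i j
  rw [mul_mapMat]
  simp [mapMat, Matrix.one_apply, hf j]

/-- The index map of `π_2`. -/
def sig (N : ℕ) (hN : 0 < N) (j : Fin (2 * N)) : Fin (2 * N) :=
  ⟨if j.val < N then j.val else if j.val = 2 * N - 1 then N else j.val + 1, by
    have := j.isLt
    split_ifs <;> omega⟩

/-- The index map of `π`. -/
def tau (N : ℕ) (j : Fin (2 * N)) : Fin (2 * N) :=
  ⟨if j.val ≤ N then j.val else N + (N - (j.val - N)), by
    have := j.isLt
    split_ifs <;> omega⟩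

lemma sig_injective (N : ℕ) (hN : 0 < N) : Function.Injective (sig N hN) := by
  intro a b h
  have h' := congrArg Fin.val h
  have := a.isLt
  have := b.isLt
  simp only [sig] at h'
  apply Fin.ext
  split_ifs at h' <;> omega

lemma tau_involutive (N : ℕ) : Function.Involutive (tau N) := by
  intro a
  have := a.isLt
  apply Fin.ext
  simp only [tau]
  split_ifs <;> omega

lemma pi2Mat_eq (N : ℕ) (hN : 0 < N) : pi2Mat N = mapMat (sig N hN) := by
  ext i j
  have := j.isLt
  simp only [pi2Mat, mapMat, Matrix.of_apply, Fin.ext_iff, sig]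
  by_cases h1 : j.val < N
  · simp [h1]
  · by_cases h2 : j.val = 2 * N - 1
    · have e : j.val - N + 1 = N := by omega
      simp only [if_neg h1, if_pos h2, e, Nat.mod_self, Nat.add_zero]
    · have e : (j.val - N + 1) % N = j.val - N + 1 := Nat.mod_eq_of_lt (by omega)
      have e2 : N + (j.val - N + 1) = j.val + 1 := by omega
      simp only [if_neg h1, if_neg h2, e, e2]

lemma piMat_eq (N : ℕ) : piMat N = mapMat (tau N) := by
  ext i j
  simp only [piMat, mapMat, Matrix.of_apply, Fin.ext_iff, tau]
  split_ifs <;> rfl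

lemma om_pow (N : ℕ) (hN : 0 < N) : om N ^ N = Complex.I := by
  have hN' : (N : ℂ) ≠ 0 := by exact_mod_cast hN.ne'
  rw [om, ← Complex.exp_nat_mul]
  refine Eq.trans (congrArg Complex.exp ?_) Complex.exp_pi_div_two_mul_I
  push_cast
  field_simp
  ring

lemma rhs_entry (N : ℕ) (hN : 0 < N) (c i : Fin (2 * N)) :
    ((pi2Mat N)⁻¹ * ((D0mat N).map (starRingEnd ℂ) * (Dmat N)ᵀ) * (piMat N)⁻¹ * D1mat N) c i =
      (starRingEnd ℂ (if (sig N hN c).val = N then Complex.I else 1)) *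
        Dmat N (tau N i) (sig N hN c) *
        (if i.val < N then om N ^ i.val else (starRingEnd ℂ (om N)) ^ (2 * N - i.val)) := by
  rw [pi2Mat_eq N hN, piMat_eq, mapMat_inv _ (sig_injective N hN),
    mapMat_inv_of_involutive _ (tau_involutive N), D1mat, Matrix.mul_diagonal, mul_mapMat,
    mapMat_transpose_mul, D0mat, Matrix.diagonal_map (map_zero _), Matrix.diagonal_mul]
  rfl

/-- For `N = 2^n`, `n ≥ 1`:
`U_N† = π_2⁻¹ · (D̄_0 · D^t) · π⁻¹ · D_1`, where `D̄_0` is the entrywise complex conjugate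
of `D_0` and `D^t` is the transpose of `D`. -/
theorem Umat_conjTranspose_factorization (n N : ℕ) (hn : 1 ≤ n) (hN : N = 2 ^ n) :
    (Umat N)ᴴ =
      (pi2Mat N)⁻¹ * ((D0mat N).map (starRingEnd ℂ) * (Dmat N)ᵀ) * (piMat N)⁻¹ * D1mat N := by
  have hN0 : 0 < N := by rw [hN]; positivity
  clear hN hn
  have hI := om_pow N hN0
  have hI' : (starRingEnd ℂ (om N)) ^ N = -Complex.I := by
    rw [← map_pow, hI, Complex.conj_I]
  ext c i
  rw [rhs_entry N hN0, Matrix.conjTranspose_apply]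
  have hc := c.isLt
  have hi := i.isLt
  simp only [Umat, Dmat, Matrix.of_apply, ← starRingEnd_apply]
  by_cases c0 : c.val = 0
  · have s : (sig N hN0 c).val = 0 := by simp only [sig]; split_ifs <;> omega
    by_cases i0 : i.val = 0
    · have t : (tau N i).val = 0 := by simp only [tau]; split_ifs <;> omega
      simp [c0, s, i0, t, hN0, hN0.ne]
    · have t : (tau N i).val ≠ 0 := by simp only [tau]; split_ifs <;> omega
      simp [c0, s, i0, t]
  by_cases c1 : c.val < N
  · have s : (sig N hN0 c).val = c.val := by simp only [sig]; split_ifs <;> omega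
    rw [s, if_neg c0, if_pos c1, if_neg c1.ne, if_neg c0, if_neg c1.ne, if_pos c1]
    by_cases i1 : i.val = c.val
    · have t : (tau N i).val = c.val := by simp only [tau]; split_ifs <;> omega
      rw [t, if_pos i1, if_neg (by omega), if_pos rfl, if_neg (by omega), if_pos (by omega), i1]
      simp
      ring
    · have t : (tau N i).val ≠ c.val := by simp only [tau]; split_ifs <;> omega
      rw [if_neg i1, if_neg t]
      by_cases i2 : i.val = N + (N - c.val)
      · have t : (tau N i).val = N + c.val := by simp only [tau]; split_ifs <;> omega
        have e : 2 * N - i.val = c.val := by omega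
        rw [if_pos i2, if_pos t, if_neg (by omega), e]
        simp
        ring
      · have t : (tau N i).val ≠ N + c.val := by simp only [tau]; split_ifs <;> omega
        rw [if_neg i2, if_neg t]
        simp
  by_cases c2 : c.val = 2 * N - 1
  · have s : (sig N hN0 c).val = N := by simp only [sig]; split_ifs <;> omega
    rw [s, if_neg c0, if_neg c1, if_pos c2, if_pos rfl, if_neg hN0.ne', if_pos rfl]
    by_cases i1 : i.val = N
    · have t : (tau N i).val = N := by simp only [tau]; split_ifs <;> omega
      have e : 2 * N - i.val = N := by omega
      rw [if_pos i1, if_pos t, if_neg (by omega), e, hI']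
      simp
    · have t : (tau N i).val ≠ N := by simp only [tau]; split_ifs <;> omega
      rw [if_neg i1, if_neg t]
      simp
  · have s : (sig N hN0 c).val = c.val + 1 := by simp only [sig]; split_ifs <;> omega
    have e1 : c.val + 1 - N = c.val - N + 1 := by omega
    rw [s, if_neg c0, if_neg c1, if_neg c2, if_neg (show ¬ c.val + 1 = N by omega),
      if_neg (show ¬ c.val + 1 = 0 by omega), if_neg (show ¬ c.val + 1 = N by omega),
      if_neg (show ¬ c.val + 1 < N by omega), e1]
    by_cases i1 : i.val = c.val - N + 1
    · have t : (tau N i).val = c.val - N + 1 := by simp only [tau]; split_ifs <;> omega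
      rw [t, if_pos i1, if_neg (by omega), if_pos rfl, if_neg (by omega), if_pos (by omega), i1]
      simp
      ring
    · have t : (tau N i).val ≠ c.val - N + 1 := by simp only [tau]; split_ifs <;> omega
      rw [if_neg i1, if_neg t]
      by_cases i2 : i.val = N + (N - 1 - (c.val - N))
      · have t : (tau N i).val = c.val + 1 := by simp only [tau]; split_ifs <;> omega
        have e : 2 * N - i.val = c.val - N + 1 := by omega
        rw [if_pos i2, if_pos t, if_neg (by omega), e]
        simp
        ring
      · have t : (tau N i).val ≠ c.val + 1 := by simp only [tau]; split_ifs <;> omega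
        rw [if_neg i2, if_neg t]
        simp
end

section
/- Let N ≥ 1. The discrete Hartley transform A_N = (1/√N)·[cas(2πjk/N)]_{j,k=0,…,N−1}, where cas(x) := cos(x) + sin(x), is an orthogonal matrix: A_N·A_N^t = I_N. -/
open Matrix

/-- The discrete Hartley transform matrix `A_N = (1/√N)·[cas(2πjk/N)]`, with
`cas(x) = cos(x) + sin(x)`, as a real matrix. -/
noncomputable def hartleyR (N : ℕ) : Matrix (Fin N) (Fin N) ℝ :=
  Matrix.of fun j k =>
    (1 / Real.sqrt N) *
      (Real.cos (2 * Real.pi * (j.val * k.val) / N) +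
        Real.sin (2 * Real.pi * (j.val * k.val) / N))

/-- The sum of the powers of an `N`-th root of unity. -/
theorem hartley_expsum (N : ℕ) (hN : 1 ≤ N) (m : ℤ) :
    ∑ k : Fin N, Complex.exp (((2 * Real.pi * (m * (k.val : ℝ)) / N : ℝ) : ℂ) * Complex.I)
      = if (N : ℤ) ∣ m then (N : ℂ) else 0 := by
  have hN0 : (N : ℂ) ≠ 0 := by
    exact_mod_cast (by omega : N ≠ 0)
  have hz := Complex.isPrimitiveRoot_exp N (by omega)
  set ζ := Complex.exp (2 * Real.pi * Complex.I / N) with hζ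
  have hterm : ∀ k : Fin N,
      Complex.exp (((2 * Real.pi * (m * (k.val : ℝ)) / N : ℝ) : ℂ) * Complex.I)
        = (ζ ^ m) ^ k.val := by
    intro k
    rw [hζ, ← Complex.exp_int_mul, ← Complex.exp_nat_mul]
    congr 1
    push_cast
    ring
  rw [Finset.sum_congr rfl fun k _ => hterm k, Fin.sum_univ_eq_sum_range (fun k => (ζ ^ m) ^ k)]
  have hiff := hz.zpow_eq_one_iff_dvd m
  split_ifs with h
  · rw [hiff.2 h]
    simp
  · have h1 : ζ ^ m ≠ 1 := fun h' => h (hiff.1 h')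
    have hpow : (ζ ^ m) ^ N = 1 := by
      rw [← zpow_natCast, ← _root_.zpow_mul, mul_comm, _root_.zpow_mul, zpow_natCast, hz.pow_eq_one,
        _root_.one_zpow]
    rw [geom_sum_eq h1, hpow]
    simp

theorem hartley_cossum (N : ℕ) (hN : 1 ≤ N) (m : ℤ) :
    ∑ k : Fin N, Real.cos (2 * Real.pi * (m * (k.val : ℝ)) / N)
      = if (N : ℤ) ∣ m then (N : ℝ) else 0 := by
  have h := congrArg Complex.re (hartley_expsum N hN m)
  rw [Complex.re_sum] at h
  simp only [Complex.exp_ofReal_mul_I_re] at h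
  rw [h]
  split_ifs <;> simp

theorem hartley_sinsum (N : ℕ) (hN : 1 ≤ N) (m : ℤ) :
    ∑ k : Fin N, Real.sin (2 * Real.pi * (m * (k.val : ℝ)) / N) = 0 := by
  have h := congrArg Complex.im (hartley_expsum N hN m)
  rw [Complex.im_sum] at h
  simp only [Complex.exp_ofReal_mul_I_im] at h
  rw [h]
  split_ifs <;> simp

/-- For `N ≥ 1`, the discrete Hartley transform is orthogonal: `A_N · A_N^t = I_N`. -/
theorem hartley_orthogonal (N : ℕ) (hN : 1 ≤ N) :
    hartleyR N * (hartleyR N)ᵀ = 1 := by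
  ext j l
  have hpos : (0 : ℝ) < N := by exact_mod_cast hN
  have hsq : (1 / Real.sqrt N) * (1 / Real.sqrt N) = 1 / (N : ℝ) := by
    rw [div_mul_div_comm, Real.mul_self_sqrt hpos.le, one_mul]
  have hterm : ∀ k : Fin N, hartleyR N j k * hartleyR N l k
      = 1 / (N : ℝ) *
        (Real.cos (2 * Real.pi * ((((j.val : ℤ) - l.val : ℤ) : ℝ) * (k.val : ℝ)) / N)
        + Real.sin (2 * Real.pi * ((((j.val : ℤ) + l.val : ℤ) : ℝ) * (k.val : ℝ)) / N)) := by
    intro k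
    have e1 : 2 * Real.pi * ((((j.val : ℤ) - l.val : ℤ) : ℝ) * (k.val : ℝ)) / N
        = 2 * Real.pi * (j.val * k.val) / N - 2 * Real.pi * (l.val * k.val) / N := by
      push_cast
      ring
    have e2 : 2 * Real.pi * ((((j.val : ℤ) + l.val : ℤ) : ℝ) * (k.val : ℝ)) / N
        = 2 * Real.pi * (j.val * k.val) / N + 2 * Real.pi * (l.val * k.val) / N := by
      push_cast
      ring
    rw [e1, e2, Real.cos_sub, Real.sin_add, ← hsq]
    simp only [hartleyR, Matrix.of_apply]
    ring
  rw [Matrix.mul_apply]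
  simp only [Matrix.transpose_apply]
  rw [Finset.sum_congr rfl fun k _ => hterm k, ← Finset.mul_sum, Finset.sum_add_distrib,
    hartley_cossum N hN, hartley_sinsum N hN, Matrix.one_apply, add_zero]
  by_cases hjl : j = l
  · subst hjl
    simp [hpos.ne']
  · have hnd : ¬ (N : ℤ) ∣ ((j.val : ℤ) - l.val) := by
      intro hd
      have hj := j.isLt
      have hl := l.isLt
      have h0 := Int.eq_zero_of_abs_lt_dvd hd (by rw [abs_lt]; constructor <;> omega)
      exact hjl (Fin.ext (by omega))
    rw [if_neg hnd, if_neg hjl, mul_zero]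
end
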